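/- The number h = 532611841 is prime, the multiplicative order of 3 in the unit group (Z/hZ)^* equals f = 88768640, and moreover f^2 - 4f ≥ 160·h and h ≥ 484. -/

import Mathlib

theorem ne_one_aux (a : ℕ) (ha : a % 532611841 ≠ 1) : ((a : ℕ) : ZMod 532611841) ≠ 1 := by
  rwa [Ne, ← Nat.cast_one, ZMod.natCast_eq_natCast_iff']

theorem prime_dvd_aux (p : ℕ) (hp : p.Prime) (hd : p ∣ 532611840) :
    p = 2 ∨ p = 3 ∨ p = 5 ∨ p = 53 ∨ p = 2617 := by
  have h : (532611840 : ℕ) = 2 ^ 8 * 3 * 5 * 53 * 2617 := by norm_num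
  rw [h, hp.dvd_mul, hp.dvd_mul, hp.dvd_mul, hp.dvd_mul] at hd
  rcases hd with (((hd | hd) | hd) | hd) | hd
  · exact Or.inl ((Nat.prime_dvd_prime_iff_eq hp (by norm_num)).1 (hp.dvd_of_dvd_pow hd))
  · exact Or.inr (Or.inl ((Nat.prime_dvd_prime_iff_eq hp (by norm_num)).1 hd))
  · exact Or.inr (Or.inr (Or.inl ((Nat.prime_dvd_prime_iff_eq hp (by norm_num)).1 hd)))
  · exact Or.inr (Or.inr (Or.inr (Or.inl ((Nat.prime_dvd_prime_iff_eq hp (by norm_num)).1 hd))))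
  · exact Or.inr (Or.inr (Or.inr (Or.inr ((Nat.prime_dvd_prime_iff_eq hp (by norm_num)).1 hd))))

theorem prime_aux : Nat.Prime 532611841 := by
  apply lucas_primality 532611841 (7 : ZMod 532611841)
  · norm_num only
    reduce_mod_char
  · intro p hp hd
    rcases prime_dvd_aux p hp hd with rfl | rfl | rfl | rfl | rfl <;> norm_num only <;>
      reduce_mod_char <;> exact ne_one_aux (OfNat.ofNat _) (by norm_num)

/-- `h = 532611841` is prime, the multiplicative order of `3` in `(ℤ/hℤ)ˣ` is `88768640`,
and `f^2 - 4f ≥ 160·h` and `h ≥ 484`. -/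
theorem stmt_10 :
    Nat.Prime 532611841 ∧
    orderOf ((3 : ℕ) : ZMod 532611841) = 88768640 ∧
    (88768640 : ℕ) ^ 2 - 4 * 88768640 ≥ 160 * 532611841 ∧
    (532611841 : ℕ) ≥ 484 := by
  refine ⟨prime_aux, ?_, by norm_num, by norm_num⟩
  rw [Nat.cast_ofNat]
  apply orderOf_eq_of_pow_and_pow_div_prime (by norm_num)
  · reduce_mod_char
  · intro p hp hd
    rcases prime_dvd_aux p hp (hd.trans (by norm_num)) with rfl | rfl | rfl | rfl | rfl
    · norm_num only
      reduce_mod_char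
      exact ne_one_aux (OfNat.ofNat _) (by norm_num)
    · norm_num at hd
    all_goals
      norm_num only
      reduce_mod_char
      exact ne_one_aux (OfNat.ofNat _) (by norm_num)
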